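/- A connected graph G contains an H-factor for every set-valued function H : V(G) → {{1},{0,2}} with |H⁻¹(1)| even if and only if ω(G − S) ≤ |S| + 1 for every S ⊆ V(G), where ω denotes the number of connected components. -/

import Mathlib

namespace LuKano

open SimpleGraph

/-- Blow-up of `G` along `f : W → V`: copies of one vertex are pairwise adjacent. -/
def blow {V W : Type*} (G : SimpleGraph V) (f : W → V) : SimpleGraph W where
  Adj x y := x ≠ y ∧ (f x = f y ∨ G.Adj (f x) (f y))
  symm := ⟨fun _ _ h => ⟨h.1.symm, h.2.imp Eq.symm fun h => h.symm⟩⟩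
  loopless := ⟨fun _ h => h.1 rfl⟩

theorem blow_matching {V W : Type*} [Fintype V] [Fintype W] (G : SimpleGraph V) (f : W → V)
    (hf : Function.Surjective f) (hW : Even (Nat.card W))
    (h : ∀ S : Finset V,
        Nat.card ((G.induce ((↑S : Set V)ᶜ)).ConnectedComponent) ≤ S.card + 1) :
    ∃ M : (blow G f).Subgraph, M.IsPerfectMatching := by
  classical
  rw [SimpleGraph.tutte]
  intro u hu
  unfold IsTutteViolator at hu
  set D := ((⊤ : (blow G f).Subgraph).deleteVerts u) with hD
  have hverts : ∀ x, x ∈ D.verts ↔ x ∉ u := by intro x; simp [hD]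
  have hodd := D.coe.odd_ncard_oddComponents
  have hcard : Nat.card D.verts + u.ncard = Nat.card W := by
    have : D.verts = uᶜ := by ext x; simp [hverts]
    rw [this, Nat.card_coe_set_eq, add_comm, Set.ncard_add_ncard_compl]
  let S : Finset V := Finset.univ.filter fun v => ∀ x, f x = v → x ∈ u
  have hS : S.card ≤ u.ncard := by
    have : (S : Set V) ⊆ f '' u := by
      intro v hv
      obtain ⟨x, rfl⟩ := hf v
      exact ⟨x, (Finset.mem_filter.1 hv).2 x rfl, rfl⟩
    calc S.card = (S : Set V).ncard := (Set.ncard_coe_finset S).symm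
      _ ≤ (f '' u).ncard := Set.ncard_le_ncard this (Set.toFinite _)
      _ ≤ u.ncard := Set.ncard_image_le (Set.toFinite _)
  have hg : ∀ v : ((↑S : Set V)ᶜ : Set V), ∃ x : D.verts, f x.1 = v.1 := by
    rintro ⟨v, hv⟩
    have : ¬ ∀ x, f x = v → x ∈ u := fun hh => hv (by simpa [S] using hh)
    push Not at this
    obtain ⟨x, hx, hxu⟩ := this
    exact ⟨⟨x, (hverts x).2 hxu⟩, hx⟩
  choose g hg using hg
  have hadj : ∀ x y : D.verts, D.coe.Adj x y ↔ (blow G f).Adj x.1 y.1 := by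
    intro x y
    have hx := (hverts x.1).1 x.2
    have hy := (hverts y.1).1 y.2
    simp [hD, hx, hy]
  let φ : G.induce ((↑S : Set V)ᶜ) →g D.coe :=
    { toFun := g
      map_rel' := by
        intro a b hab
        have hab' : G.Adj a.1 b.1 := hab
        rw [hadj]
        refine ⟨?_, Or.inr (by rw [hg, hg]; exact hab')⟩
        intro he
        apply hab'.ne
        rw [← hg a, ← hg b, he] }
  have hsurj : Function.Surjective (ConnectedComponent.map φ) := by
    intro c
    induction c using ConnectedComponent.ind with
    | h x =>
      have hxS : f x.1 ∈ ((↑S : Set V)ᶜ : Set V) := by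
        intro hh
        exact (hverts x.1).1 x.2 ((Finset.mem_filter.1 hh).2 x.1 rfl)
      refine ⟨connectedComponentMk _ ⟨f x.1, hxS⟩, ?_⟩
      rw [ConnectedComponent.map_mk, ConnectedComponent.eq]
      change D.coe.Reachable (g ⟨f x.1, hxS⟩) x
      by_cases he : g ⟨f x.1, hxS⟩ = x
      · rw [he]
      · refine Adj.reachable ((hadj _ _).2 ⟨fun hh => he (Subtype.ext hh), Or.inl (hg _)⟩)
  have h1 := Nat.card_le_card_of_surjective _ hsurj
  have h2 : D.coe.oddComponents.ncard ≤ Nat.card D.coe.ConnectedComponent := by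
    rw [← Set.ncard_univ]
    exact Set.ncard_le_ncard (Set.subset_univ _) (Set.toFinite _)
  have h3 := h S
  have h4 : D.coe.oddComponents.ncard = u.ncard + 1 := by omega
  rw [h4] at hodd
  rw [← hcard] at hW
  grind

theorem factor_of_matching {V W : Type*} [Fintype V] (G : SimpleGraph V) (f : W → V)
    (H : V → Set ℕ)
    (hf : ∀ v, (H v = {1} ∧ ∃ x, ∀ y, f y = v ↔ y = x) ∨
      (H v = {0, 2} ∧ ∃ x₀ x₁, x₀ ≠ x₁ ∧ ∀ y, f y = v ↔ y = x₀ ∨ y = x₁))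
    (M : (blow G f).Subgraph) (hM : M.IsPerfectMatching) :
    ∃ F : SimpleGraph V, F ≤ G ∧ ∀ v, Nat.card (F.neighborSet v) ∈ H v := by
  classical
  rw [Subgraph.isPerfectMatching_iff] at hM
  choose p hp hpu using hM
  have hinv : ∀ x, p (p x) = x := fun x => ((hpu (p x)) x (hp x).symm).symm
  have hpadj : ∀ x, x ≠ p x ∧ (f x = f (p x) ∨ G.Adj (f x) (f (p x))) := fun x => (hp x).adj_sub
  let F : SimpleGraph V :=
    { Adj := fun a b => G.Adj a b ∧ ∃! x, f x = a ∧ f (p x) = b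
      symm := ⟨by
        rintro a b ⟨hab, x, ⟨hx1, hx2⟩, hx⟩
        refine ⟨hab.symm, p x, ⟨hx2, by rw [hinv]; exact hx1⟩, ?_⟩
        rintro y ⟨hy1, hy2⟩
        rw [← hx (p y) ⟨hy2, by rw [hinv]; exact hy1⟩, hinv]⟩
      loopless := ⟨fun a h => h.1.ne rfl⟩ }
  have hF : ∀ a b, F.Adj a b ↔ G.Adj a b ∧ ∃! x, f x = a ∧ f (p x) = b := fun _ _ => Iff.rfl
  refine ⟨F, fun a b hab => hab.1, fun v => ?_⟩
  rw [Nat.card_coe_set_eq]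
  rcases hf v with ⟨hv, x, hx⟩ | ⟨hv, x₀, x₁, hne, hx⟩
  · have hfx : f x = v := (hx x).2 rfl
    have : F.neighborSet v = {f (p x)} := by
      ext b
      rw [mem_neighborSet, hF, Set.mem_singleton_iff]
      constructor
      · rintro ⟨_, y, ⟨hy1, hy2⟩, _⟩
        rw [← hy2, (hx y).1 hy1]
      · rintro rfl
        refine ⟨?_, x, ⟨hfx, rfl⟩, fun y hy => (hx y).1 hy.1⟩
        rcases (hpadj x).2 with h | h
        · exact absurd ((hx (p x)).1 (h ▸ hfx)).symm (hpadj x).1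
        · rwa [hfx] at h
    rw [this, hv]
    simp
  · have hf0 : f x₀ = v := (hx x₀).2 (Or.inl rfl)
    have hf1 : f x₁ = v := (hx x₁).2 (Or.inr rfl)
    rw [hv]
    by_cases hab : f (p x₀) = f (p x₁)
    · left
      have : F.neighborSet v = ∅ := by
        ext b
        rw [mem_neighborSet, hF]
        simp only [Set.mem_empty_iff_false, iff_false]
        rintro ⟨_, y, ⟨hy1, hy2⟩, hu⟩
        have hb : f (p x₀) = b ∧ f (p x₁) = b := by
          rcases (hx y).1 hy1 with rfl | rfl
          · exact ⟨hy2, hab ▸ hy2⟩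
          · exact ⟨hab ▸ hy2, hy2⟩
        exact hne ((hu x₀ ⟨hf0, hb.1⟩).trans (hu x₁ ⟨hf1, hb.2⟩).symm)
      rw [this]; simp
    · right
      have hn0 : f (p x₀) ≠ v := by
        intro h
        rcases (hx _).1 h with h' | h'
        · exact (hpadj x₀).1 h'.symm
        · apply hab
          have : p x₁ = x₀ := by rw [← h', hinv]
          rw [this, h', hf0, hf1]
      have hn1 : f (p x₁) ≠ v := by
        intro h
        rcases (hx _).1 h with h' | h'
        · apply hab
          have : p x₀ = x₁ := by rw [← h', hinv]
          rw [this, h', hf0, hf1]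
        · exact (hpadj x₁).1 h'.symm
      have : F.neighborSet v = {f (p x₀), f (p x₁)} := by
        ext b
        rw [mem_neighborSet, hF, Set.mem_insert_iff, Set.mem_singleton_iff]
        constructor
        · rintro ⟨_, y, ⟨hy1, hy2⟩, _⟩
          rcases (hx y).1 hy1 with rfl | rfl
          · exact Or.inl hy2.symm
          · exact Or.inr hy2.symm
        · rintro (rfl | rfl)
          · refine ⟨?_, x₀, ⟨hf0, rfl⟩, ?_⟩
            · rcases (hpadj x₀).2 with h | h
              · exact absurd (h ▸ hf0) hn0
              · rwa [hf0] at h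
            · rintro y ⟨hy1, hy2⟩
              rcases (hx y).1 hy1 with rfl | rfl
              · rfl
              · exact absurd hy2.symm hab
          · refine ⟨?_, x₁, ⟨hf1, rfl⟩, ?_⟩
            · rcases (hpadj x₁).2 with h | h
              · exact absurd (h ▸ hf1) hn1
              · rwa [hf1] at h
            · rintro y ⟨hy1, hy2⟩
              rcases (hx y).1 hy1 with rfl | rfl
              · exact absurd hy2 hab
              · rfl
      rw [this, Set.ncard_pair hab]; rfl

theorem sufficiency {V : Type*} [Fintype V] (G : SimpleGraph V)
    (h : ∀ S : Finset V,
        Nat.card ((G.induce ((↑S : Set V)ᶜ)).ConnectedComponent) ≤ S.card + 1)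
    (H : V → Set ℕ) (hH : ∀ v, H v = {1} ∨ H v = {0, 2})
    (hev : Even (Nat.card {v : V // H v = ({1} : Set ℕ)})) :
    ∃ F : SimpleGraph V, F ≤ G ∧ ∀ v, Nat.card (F.neighborSet v) ∈ H v := by
  classical
  let f : {v : V // H v = ({1} : Set ℕ)} ⊕ ({v : V // ¬ H v = ({1} : Set ℕ)} × Bool) → V :=
    Sum.elim (fun x => x.1) (fun x => x.1.1)
  have hfs : ∀ v, (H v = {1} ∧ ∃ x, ∀ y, f y = v ↔ y = x) ∨
      (H v = {0, 2} ∧ ∃ x₀ x₁, x₀ ≠ x₁ ∧ ∀ y, f y = v ↔ y = x₀ ∨ y = x₁) := by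
    intro v
    by_cases hv : H v = {1}
    · refine Or.inl ⟨hv, Sum.inl ⟨v, hv⟩, ?_⟩
      rintro (⟨y, hy⟩ | ⟨⟨y, hy⟩, b⟩)
      · simp [f]
      · simp only [f, Sum.elim_inr, reduceCtorEq, iff_false]
        rintro rfl; exact hy hv
    · refine Or.inr ⟨(hH v).resolve_left hv, Sum.inr (⟨v, hv⟩, false), Sum.inr (⟨v, hv⟩, true),
        by simp, ?_⟩
      rintro (⟨y, hy⟩ | ⟨⟨y, hy⟩, b⟩)
      · simp only [f, Sum.elim_inl, reduceCtorEq, or_self, iff_false]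
        rintro rfl; exact hv hy
      · cases b <;> simp [f]
  have hsurj : Function.Surjective f := by
    intro v
    rcases hfs v with ⟨_, x, hx⟩ | ⟨_, x, _, _, hx⟩
    · exact ⟨x, (hx x).2 rfl⟩
    · exact ⟨x, (hx x).2 (Or.inl rfl)⟩
  have hW : Even (Nat.card (
      {v : V // H v = ({1} : Set ℕ)} ⊕ ({v : V // ¬ H v = ({1} : Set ℕ)} × Bool))) := by
    rw [Nat.card_sum, Nat.card_prod]
    exact hev.add (by simp)
  obtain ⟨M, hM⟩ := blow_matching G f hsurj hW h
  exact factor_of_matching G f H hfs M hM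

theorem necessity {V : Type*} [Fintype V] (G : SimpleGraph V)
    (h : ∀ H : V → Set ℕ, (∀ v, H v = {1} ∨ H v = {0, 2}) →
        Even (Nat.card {v : V // H v = ({1} : Set ℕ)}) →
        ∃ F : SimpleGraph V, F ≤ G ∧ ∀ v, Nat.card (F.neighborSet v) ∈ H v) (S : Finset V) :
    Nat.card ((G.induce ((↑S : Set V)ᶜ)).ConnectedComponent) ≤ S.card + 1 := by
  classical
  by_contra! hlt
  set K := G.induce ((↑S : Set V)ᶜ) with hK
  have : Fintype K.ConnectedComponent := Fintype.ofFinite _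
  rw [Nat.card_eq_fintype_card] at hlt
  obtain ⟨T, hT1, hT2⟩ : ∃ T : Finset K.ConnectedComponent,
      S.card < T.card ∧ Even (S.card + T.card) := by
    by_cases he : Even (S.card + Fintype.card K.ConnectedComponent)
    · exact ⟨Finset.univ, by rw [Finset.card_univ]; omega, by rwa [Finset.card_univ]⟩
    · obtain ⟨T, _, hT⟩ := Finset.exists_subset_card_eq
        (s := (Finset.univ : Finset K.ConnectedComponent))
        (n := Fintype.card K.ConnectedComponent - 1) (by rw [Finset.card_univ]; omega)
      refine ⟨T, by omega, ?_⟩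
      rw [hT]
      grind
  have hr : ∀ c : K.ConnectedComponent, ∃ v, K.connectedComponentMk v = c :=
    fun c => c.exists_rep
  choose r hr using hr
  let R : Finset V := T.image fun c => (r c).1
  have hRc : R.card = T.card := by
    apply Finset.card_image_of_injective
    intro a b hab
    have : r a = r b := Subtype.ext hab
    rw [← hr a, ← hr b, this]
  have hdisj : Disjoint S R := by
    rw [Finset.disjoint_left]
    intro v hv hvR
    obtain ⟨c, _, rfl⟩ := Finset.mem_image.1 hvR
    exact (r c).2 hv
  have hne : ({0, 2} : Set ℕ) ≠ {1} := by
    intro h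
    have : (0 : ℕ) ∈ ({1} : Set ℕ) := h ▸ (by simp)
    simp at this
  let H : V → Set ℕ := fun v => if v ∈ S ∪ R then {1} else {0, 2}
  have hH1 : ∀ v, H v = {1} ↔ v ∈ S ∪ R := by
    intro v
    by_cases hv : v ∈ S ∪ R <;> simp only [H, hv, if_true, if_false, hne]
  obtain ⟨F, hFG, hF⟩ := h H (fun v => by
      by_cases hv : v ∈ S ∪ R <;> simp only [H, hv, if_true, if_false, true_or, or_true]) (by
      have : Nat.card {v : V // H v = ({1} : Set ℕ)} = (S ∪ R).card := by
        rw [Nat.card_congr (Equiv.subtypeEquivRight hH1), Nat.card_eq_fintype_card,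
          Fintype.card_coe]
      rw [this, Finset.card_union_of_disjoint hdisj, hRc]
      exact hT2)
  have hF1 : ∀ v, v ∈ S ∪ R → Nat.card (F.neighborSet v) = 1 := by
    intro v hv
    have := hF v
    rw [(hH1 v).2 hv] at this
    exact this
  have hF2 : ∀ v, v ∉ S ∪ R → ¬ Odd (Nat.card (F.neighborSet v)) := by
    intro v hv
    have := hF v
    simp only [H, hv, if_false] at this
    rcases this with h | h
    · rw [h]; decide
    · rw [Set.mem_singleton_iff.1 h]; decide
  have key : ∀ c ∈ T, ∃ s ∈ S, ∃ v : ((↑S : Set V)ᶜ : Set V),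
      K.connectedComponentMk v = c ∧ F.Adj s v := by
    intro c hc
    by_contra! hno
    let A : Set V := {v | ∃ hv : v ∈ ((↑S : Set V)ᶜ : Set V), K.connectedComponentMk ⟨v, hv⟩ = c}
    have hdeg : ∀ v : A, (F.induce A).degree v = Nat.card (F.neighborSet v.1) := by
      rintro ⟨v, hv, hvc⟩
      rw [← card_neighborSet_eq_degree, ← Nat.card_eq_fintype_card]
      refine Nat.card_congr (Equiv.ofBijective
        (fun w => (⟨w.1.1, w.2⟩ : F.neighborSet v)) ⟨?_, ?_⟩)
      · intro a b hab
        exact Subtype.ext (Subtype.ext (congrArg (fun z => z.1) hab))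
      · rintro ⟨w, hw⟩
        have hw' : F.Adj v w := hw
        have hwS : w ∉ S := fun hwS => hno w hwS ⟨v, hv⟩ hvc hw'.symm
        have hwA : w ∈ A := by
          refine ⟨hwS, ?_⟩
          rw [← hvc, ConnectedComponent.eq]
          exact Adj.reachable (show G.Adj w v from hFG hw'.symm)
        exact ⟨⟨⟨w, hwA⟩, hw'⟩, rfl⟩
    have hrA : (r c).1 ∈ A := ⟨(r c).2, hr c⟩
    have hrR : (r c).1 ∈ R := Finset.mem_image.2 ⟨c, hc, rfl⟩
    obtain ⟨w, hw, hwo⟩ := (F.induce A).exists_ne_odd_degree_of_exists_odd_degree ⟨(r c).1, hrA⟩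
      (by rw [hdeg, hF1 _ (Finset.mem_union_right _ hrR)]; decide)
    rw [hdeg] at hwo
    obtain ⟨w, hwS, hwc⟩ := w
    have hwR : w ∈ S ∪ R := by
      by_contra hh
      exact hF2 w hh hwo
    rcases Finset.mem_union.1 hwR with hh | hh
    · exact hwS hh
    · obtain ⟨c', _, rfl⟩ := Finset.mem_image.1 hh
      apply hw
      have : c' = c := by rw [← hwc]; exact (hr c').symm
      subst this
      rfl
  obtain ⟨c₀, _⟩ := Finset.card_pos.1 (lt_of_le_of_lt (Nat.zero_le _) hT1)
  have : Nonempty ((↑S : Set V)ᶜ : Set V) := ⟨r c₀⟩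
  have : Nonempty V := ⟨(r c₀).1⟩
  choose! s hsS v hvc hadj using key
  have hle : T.card ≤ S.card := by
    refine Finset.card_le_card_of_injOn s hsS ?_
    intro a ha b hb hab
    have h1 := hF1 (s a) (Finset.mem_union_left _ (hsS a ha))
    rw [Nat.card_eq_one_iff_unique] at h1
    have hsub := h1.1
    have := hsub.elim ⟨(v a).1, hadj a ha⟩ ⟨(v b).1, by
      have := hadj b hb
      rw [← hab] at this
      exact this⟩
    have hv : v a = v b := Subtype.ext (congrArg (fun z => z.1) this)
    rw [← hvc a ha, ← hvc b hb, hv]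
  omega

end LuKano

/-- Lu–Kano characterization: a connected graph G contains an H-factor for every
H : V(G) → {{1},{0,2}} with |H⁻¹(1)| even if and only if ω(G−S) ≤ |S|+1 for every S ⊆ V(G). -/
theorem stmt_16 {V : Type*} [Fintype V] (G : SimpleGraph V) (hG : G.Connected) :
    (∀ H : V → Set ℕ, (∀ v, H v = {1} ∨ H v = {0, 2}) →
        Even (Nat.card {v : V // H v = ({1} : Set ℕ)}) →
        ∃ F : SimpleGraph V, F ≤ G ∧ ∀ v, Nat.card (F.neighborSet v) ∈ H v) ↔
      ∀ S : Finset V,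
        Nat.card ((G.induce ((↑S : Set V)ᶜ)).ConnectedComponent) ≤ S.card + 1 := by
  exact ⟨fun h S => LuKano.necessity G h S, fun h H hH hev => LuKano.sufficiency G h H hH hev⟩
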